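/- Fix d ≥ 2. There exists η > 0 depending only on the dimension d such that for every n ≥ 1, every finite set A ⊆ ℤ^d with A ⊇ B[n], every x ∈ B[n/2] and every y ∉ A, one has P_x(ξ(τ_A) = y) ≥ η · P_0(ξ(τ_A) = y), where τ_A = inf{t : ξ(t) ∉ A} is the exit time of the simple random walk ξ from A. -/

import Mathlib

open MeasureTheory Filter
open scoped ENNReal

noncomputable section

/-- The `k`-th binary digit of `x ∈ [0,1)` (after the binary point). -/
def bit (x : ℝ) (k : ℕ) : Bool := ⌊x * 2 ^ (k + 1)⌋ % 2 == 1

/-- From one uniform sample on `[0,1]`, extract countably many independent uniform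
samples on `[0,1]`, using disjoint subsequences of binary digits. -/
def uSlice (x : ℝ) (i : ℕ) : ℝ :=
  ∑' j : ℕ, if bit x (Nat.pair i j) then ((2 : ℝ) ^ (-(j : ℤ) - 1)) else 0

/-- The base probability space: Lebesgue measure restricted to `[0,1]`. -/
def μ0 : Measure ℝ := volume.restrict (Set.Icc 0 1)

/-- The vertex set of the lattice `ℤ^d`. -/
abbrev V (d : ℕ) := Fin d → ℤ

instance (d : ℕ) : MeasurableSpace (Finset (V d)) := ⊤

open Classical in
/-- `B[r]`: the Euclidean ball of radius `r` in `ℤ^d`, as a `Finset`. -/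
def ball (d : ℕ) (r : ℝ) : Finset (V d) :=
  (Finset.Icc (fun _ => -⌈r⌉) (fun _ => ⌈r⌉)).filter
    (fun y => Real.sqrt (∑ i, ((y i : ℝ)) ^ 2) ≤ r)

/-- `b_n`: the number of lattice points in the Euclidean ball of radius `n`. -/
def bn (d n : ℕ) : ℕ := (ball d n).card

/-- The `2d` unit vectors of `ℤ^d` (the possible steps of the simple random walk). -/
def unitVecs (d : ℕ) : Finset (V d) :=
  Finset.image
    (fun p : Fin d × Bool => fun j => if j = p.1 then (if p.2 then 1 else -1) else 0)
    Finset.univ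

/-- Given `u` uniform on `[0,1]`, `pick S u` is a uniformly chosen element of `S`. -/
def pick {d : ℕ} (S : Finset (V d)) (u : ℝ) : V d :=
  if h : S.Nonempty then
    (S.equivFin.symm ⟨(⌊u * S.card⌋).toNat % S.card,
      Nat.mod_lt _ (Finset.card_pos.mpr h)⟩).val
  else 0

/-- Position at time `t` of the simple random walk started at `x`, driven by the
random seed `ω`: the steps `pick (unitVecs d) (uSlice ω i)` are i.i.d. uniform on
the `2d` unit vectors when `ω` is uniform on `[0,1]`. -/
def walk {d : ℕ} (x : V d) (ω : ℝ) (t : ℕ) : V d :=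
  x + ∑ i ∈ Finset.range t, pick (unitVecs d) (uSlice ω i)

/-- `t_S`: the first time the walk started at `x` is outside `S`. -/
def exitT {d : ℕ} (S : Finset (V d)) (x : V d) (ω : ℝ) : ℕ :=
  sInf {t | walk x ω t ∉ S}

/-- The position `ξ(t_S)` at which the walk started at `x` first exits `S`. -/
def hitPt {d : ℕ} (S : Finset (V d)) (x : V d) (ω : ℝ) : V d :=
  walk x ω (exitT S x ω)

/-- `Add[ξ,S]`: add to `S` the exit point of a random walk started at `x`. -/
def addPt {d : ℕ} (S : Finset (V d)) (x : V d) (ω : ℝ) : Finset (V d) :=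
  insert (hitPt S x ω) S

/-- `P_x(ξ(τ_A) = y)`: the probability that the walk started at `x` exits `A` at `y`. -/
def hitProb {d : ℕ} (A : Finset (V d)) (x y : V d) : ℝ≥0∞ :=
  μ0 {ω | hitPt A x ω = y}

/-- The outer boundary `∂A`: vertices outside `A` with a neighbour in `A`. -/
def outb {d : ℕ} (A : Finset (V d)) : Finset (V d) :=
  (A.biUnion fun x => (unitVecs d).image (fun e => x + e)) \ A

/-- `DA_X(S)`: the IDLA aggregate obtained from `S` by launching one particle from each
point of the list `xs` in turn (driven by independent slices of the seed `ω`). -/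
def daFrom {d : ℕ} : Finset (V d) → List (V d) → ℝ → Finset (V d)
  | S, [], _ => S
  | S, x :: xs, ω => daFrom (addPt S x (uSlice ω 0)) xs (uSlice ω 1)

/-- The law of the IDLA aggregate `DA_X(S)`. -/
def daLaw {d : ℕ} (S : Finset (V d)) (xs : List (V d)) : Measure (Finset (V d)) :=
  μ0.map (fun ω => daFrom S xs ω)

/-- One uIDLA step: launch a particle from a uniformly chosen point of `S`. -/
def uStep {d : ℕ} (S : Finset (V d)) (ω : ℝ) : Finset (V d) :=
  addPt S (pick S (uSlice ω 0)) (uSlice ω 1)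

/-- `A_k(S)`: the uIDLA aggregate obtained by adding `k` particles to `S`,
each started at a uniform point of the current aggregate. -/
def uAggFrom {d : ℕ} (S : Finset (V d)) (ω : ℝ) : ℕ → Finset (V d)
  | 0 => S
  | k + 1 => uStep (uAggFrom S ω k) (uSlice ω k)

/-- The law of the uIDLA aggregate `A_k(S)`. -/
def uLaw {d : ℕ} (S : Finset (V d)) (k : ℕ) : Measure (Finset (V d)) :=
  μ0.map (fun ω => uAggFrom S ω k)

/-- One step of the subset uIDLA `A_·(E;m)`: at step `k`, perform a uIDLA step
with probability `|E|/(m+k)` and otherwise do nothing. -/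
def subStep {d : ℕ} (m k : ℕ) (E : Finset (V d)) (ω : ℝ) : Finset (V d) :=
  if uSlice ω 0 * ((m : ℝ) + k) ≤ E.card then uStep E (uSlice ω 1) else E

/-- The subset uIDLA `A_n(E;m)`. -/
def subAggFrom {d : ℕ} (E : Finset (V d)) (m : ℕ) (ω : ℝ) : ℕ → Finset (V d)
  | 0 => E
  | k + 1 => subStep m k (subAggFrom E m ω k) (uSlice ω k)

/-- The law of the subset uIDLA `A_n(E;m)`. -/
def subLaw {d : ℕ} (E : Finset (V d)) (m k : ℕ) : Measure (Finset (V d)) :=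
  μ0.map (fun ω => subAggFrom E m ω k)

/-- Stochastic domination of random finite subsets of `ℤ^d`: `μ` dominates `ν` if
there is a coupling under which the sample of `ν` is a.s. contained in that of `μ`. -/
def StochDom {d : ℕ} (μ ν : Measure (Finset (V d))) : Prop :=
  ∃ π : Measure (Finset (V d) × Finset (V d)), IsProbabilityMeasure π ∧
    π.map Prod.fst = μ ∧ π.map Prod.snd = ν ∧ π {p | p.2 ⊆ p.1} = 1

/-- A `Geometric(1/2)` sample (taking value `j ≥ 0` with probability `2^{-(j+1)}`)
produced from a uniform sample `u` on `[0,1]` by inverting the CDF. -/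
def geom (u : ℝ) : ℕ := sInf {j : ℕ | u ≤ 1 - (2 : ℝ) ^ (-(j : ℤ) - 1)}

/-- The parent of vertex `j ≥ 1` in the uniform random recursive tree (vertex `0` is
the root): uniform on `{0, …, j-1}` when the seed is uniform on `[0,1]`. -/
def parent (ω : ℝ) (j : ℕ) : ℕ := (⌊uSlice ω (Nat.pair 0 j) * j⌋).toNat % j

/-- The reaching time of vertex `j` in a uniform random recursive tree whose edges
carry i.i.d. `Geometric(1/2)` weights: the sum of the weights on the path from the
root to `j`. (The `min` is a.s. inoperative, since a.s. `parent ω (j+1) ≤ j`.) -/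
def reach (ω : ℝ) : ℕ → ℕ
  | 0 => 0
  | j + 1 => reach ω (min (parent ω (j + 1)) j) + geom (uSlice ω (Nat.pair 1 (j + 1)))
termination_by j => j
decreasing_by exact Nat.lt_succ_of_le (min_le_right _ _)

end


namespace RW

noncomputable section

lemma bit_add_one (x : ℝ) (k : ℕ) : bit (x + 1) k = bit x k := by
  unfold bit
  have : (x + 1) * 2 ^ (k + 1) = x * 2 ^ (k + 1) + ((2 ^ (k + 1) : ℤ) : ℝ) := by
    push_cast; ring
  rw [this, Int.floor_add_intCast, pow_succ (2:ℤ), Int.add_mul_emod_self_right]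

lemma bit_sub_one (x : ℝ) (k : ℕ) : bit (x - 1) k = bit x k := by
  rw [← bit_add_one, sub_add_cancel]

lemma bit_succ (x : ℝ) (k : ℕ) : bit x (k + 1) = bit (2 * x) k := by
  unfold bit
  have : x * 2 ^ (k + 1 + 1) = 2 * x * 2 ^ (k + 1) := by ring
  rw [this]

lemma bit_zero_lt {x : ℝ} (h0 : 0 ≤ x) (h1 : x < 1 / 2) : bit x 0 = false := by
  have : ⌊x * 2 ^ (0 + 1)⌋ = 0 := by
    rw [Int.floor_eq_iff]; norm_num; constructor <;> linarith
  unfold bit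
  rw [this]; rfl

lemma bit_zero_ge {x : ℝ} (h0 : 1 / 2 ≤ x) (h1 : x < 1) : bit x 0 = true := by
  have : ⌊x * 2 ^ (0 + 1)⌋ = 1 := by
    rw [Int.floor_eq_iff]; norm_num; constructor <;> linarith
  unfold bit
  rw [this]; rfl

lemma measurable_bit (k : ℕ) : Measurable (fun x => bit x k) := by
  unfold bit
  have h1 : Measurable (fun x : ℝ => ⌊x * 2 ^ (k + 1)⌋) :=
    Int.measurable_floor.comp (measurable_id.mul_const _)
  exact (measurable_of_countable (fun z : ℤ => (z % 2 == 1))).comp h1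

/-- fair coin -/
def coin : Measure Bool := (2⁻¹ : ℝ≥0∞) • (Measure.dirac false + Measure.dirac true)

instance : IsProbabilityMeasure coin := by
  constructor
  simp [coin, ENNReal.inv_two_add_inv_two]

instance : IsProbabilityMeasure μ0 := by
  constructor
  simp [μ0]

lemma vol_cyl (n : ℕ) : ∀ t : ℕ → Set Bool,
    volume (Set.Ico (0:ℝ) 1 ∩ {x | ∀ k < n, bit x k ∈ t k}) = ∏ k ∈ Finset.range n, coin (t k) := by
  induction n with
  | zero => intro t; simp
  | succ n ih =>
    intro t
    set S : Set ℝ := Set.Ico (0:ℝ) 1 ∩ {x | ∀ k < n, bit x k ∈ t (k + 1)} with hS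
    have hSm : MeasurableSet S := by
      refine measurableSet_Ico.inter ?_
      have : {x | ∀ k < n, bit x k ∈ t (k + 1)} =
          ⋂ k ∈ Set.Iio n, (fun x => bit x k) ⁻¹' (t (k + 1)) := by
        ext x; simp
      rw [this]
      exact MeasurableSet.biInter (Set.to_countable _)
        (fun k _ => measurable_bit k (MeasurableSet.of_discrete))
    have hvS := ih (fun k => t (k + 1))
    have hA : volume ((2 * · : ℝ → ℝ) ⁻¹' S) = 2⁻¹ * volume S := by
      rw [Real.volume_preimage_mul_left (by norm_num)]
      congr 1
      rw [abs_of_pos (by norm_num), ENNReal.ofReal_inv_of_pos (by norm_num)]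
      simp
    have hB : volume ((fun x : ℝ => 2 * x - 1) ⁻¹' S) = 2⁻¹ * volume S := by
      have : (fun x : ℝ => 2 * x - 1) ⁻¹' S = (2 * · : ℝ → ℝ) ⁻¹' ((fun x => x + (-1)) ⁻¹' S) := by
        ext x; simp [sub_eq_add_neg]
      rw [this, Real.volume_preimage_mul_left (by norm_num), measure_preimage_add_right]
      congr 1
      rw [abs_of_pos (by norm_num), ENNReal.ofReal_inv_of_pos (by norm_num)]
      simp
    have hsplit : Set.Ico (0:ℝ) 1 ∩ {x | ∀ k < n + 1, bit x k ∈ t k} =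
        ({x | false ∈ t 0} ∩ (2 * · : ℝ → ℝ) ⁻¹' S) ∪
          ({x | true ∈ t 0} ∩ (fun x : ℝ => 2 * x - 1) ⁻¹' S) := by
      ext x
      simp only [hS, Set.mem_inter_iff, Set.mem_Ico, Set.mem_ofPred_eq, Set.mem_union,
        Set.mem_preimage]
      constructor
      · rintro ⟨⟨h0, h1⟩, h⟩
        by_cases hx : x < 1 / 2
        · left
          refine ⟨?_, ⟨by linarith, by linarith⟩, fun k hk => ?_⟩
          · rw [← bit_zero_lt h0 hx]; exact h 0 (by omega)
          · rw [← bit_succ]; exact h _ (by omega)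
        · right
          push Not at hx
          refine ⟨?_, ⟨by linarith, by linarith⟩, fun k hk => ?_⟩
          · rw [← bit_zero_ge hx h1]; exact h 0 (by omega)
          · rw [bit_sub_one, ← bit_succ]; exact h _ (by omega)
      · rintro (⟨hf, ⟨h0, h1⟩, h⟩ | ⟨hf, ⟨h0, h1⟩, h⟩)
        · refine ⟨⟨by linarith, by linarith⟩, fun k hk => ?_⟩
          rcases k with _ | k
          · rw [bit_zero_lt (by linarith) (by linarith)]; exact hf
          · rw [bit_succ]; exact h k (by omega)
        · refine ⟨⟨by linarith, by linarith⟩, fun k hk => ?_⟩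
          rcases k with _ | k
          · rw [bit_zero_ge (by linarith) (by linarith)]; exact hf
          · rw [bit_succ, ← bit_sub_one]; exact h k (by omega)
    rw [hsplit, measure_union]
    · rw [Finset.prod_range_succ', ← hvS, ← hS]
      by_cases hf : false ∈ t 0 <;> by_cases ht : true ∈ t 0 <;>
        simp only [hf, ht, Set.ofPred_true, Set.univ_inter, Set.ofPred_false, Set.empty_inter,
          measure_empty, add_zero, zero_add, hA, hB] <;>
        simp [coin, hf, ht, mul_comm] <;> ring
    · rw [Set.disjoint_left]
      rintro x ⟨_, ⟨h0, h1⟩, _⟩ ⟨_, ⟨h2, h3⟩, _⟩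
      simp only at h0 h1 h2 h3
      linarith
    · refine MeasurableSet.inter (MeasurableSet.const _) (hSm.preimage (by fun_prop))

lemma map_bits : μ0.map (fun x k => bit x k) = Measure.infinitePi (fun _ : ℕ => coin) := by
  classical
  apply Measure.eq_infinitePi
  intro s t ht
  have hm : Measurable (fun x k => bit x k) := measurable_pi_lambda _ measurable_bit
  rw [Measure.map_apply hm (MeasurableSet.pi s.countable_toSet (fun i _ => ht i))]
  obtain ⟨n, hn⟩ : ∃ n, s ⊆ Finset.range n := s.exists_nat_subset_range
  have h := vol_cyl n (fun k => if k ∈ s then t k else Set.univ)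
  have e1 : ∏ k ∈ Finset.range n, coin (if k ∈ s then t k else Set.univ) = ∏ k ∈ s, coin (t k) := by
    rw [← Finset.prod_subset hn]
    · exact Finset.prod_congr rfl (fun k hk => by simp [hk])
    · intro k _ hk; rw [if_neg hk]; exact measure_univ
  rw [e1] at h
  rw [← h, μ0, ← Measure.restrict_congr_set Ico_ae_eq_Icc, Measure.restrict_apply]
  · congr 1
    ext x
    simp only [Set.mem_inter_iff, Set.mem_preimage, Set.mem_pi, Finset.mem_coe, Set.mem_Ico,
      Set.mem_ofPred_eq]
    constructor
    · rintro ⟨h1, h2⟩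
      refine ⟨h2, fun k _ => ?_⟩
      split_ifs with hk
      · exact h1 k hk
      · trivial
    · rintro ⟨h1, h2⟩
      refine ⟨fun k hk => ?_, h1⟩
      have := h2 k (Finset.mem_range.1 (hn hk))
      simpa [hk] using this
  · exact hm (MeasurableSet.pi s.countable_toSet (fun i _ => ht i))

/-- The real number with prescribed binary digits. -/
def ofBits (b : ℕ → Bool) : ℝ := ∑' j : ℕ, if b j then ((2 : ℝ) ^ (-(j : ℤ) - 1)) else 0

lemma pow_form (j : ℕ) : (2 : ℝ) ^ (-(j : ℤ) - 1) = (1 / 2) ^ (j + 1) := by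
  rw [show -(j : ℤ) - 1 = -((j + 1 : ℕ) : ℤ) by push_cast; ring, zpow_neg, zpow_natCast]
  simp

lemma measurable_ofBits : Measurable ofBits := by
  unfold ofBits
  apply Measurable.tsum
  intro j
  exact (measurable_of_countable (fun c : Bool => if c then ((2 : ℝ) ^ (-(j : ℤ) - 1)) else 0)).comp
    (measurable_pi_apply j)

lemma ofBits_bit {x : ℝ} (hx : x ∈ Set.Ico (0:ℝ) 1) : ofBits (fun k => bit x k) = x := by
  have h := Real.ofDigits_digits (b := 2) (by norm_num) hx
  rw [Real.ofDigits] at h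
  rw [ofBits]
  conv_rhs => rw [← h]
  congr 1
  ext j
  rw [Real.ofDigitsTerm, Real.digits, pow_form, bit]
  have h0 : 0 ≤ x * 2 ^ (j + 1) := mul_nonneg hx.1 (by positivity)
  have : ⌊x * 2 ^ (j + 1)⌋ = ((⌊x * 2 ^ (j + 1)⌋₊ : ℕ) : ℤ) := (Int.natCast_floor_eq_floor h0).symm
  rw [this]
  push_cast
  generalize ⌊x * 2 ^ (j + 1)⌋₊ = m
  rcases Nat.mod_two_eq_zero_or_one m with h | h
  · have : ((m : ℤ) % 2 == 1) = false := by
      simp; omega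
    simp [this, Fin.ofNat, h]
  · have : ((m : ℤ) % 2 == 1) = true := by
      simp; omega
    simp [this, Fin.ofNat, h]

lemma map_ofBits : (Measure.infinitePi (fun _ : ℕ => coin)).map ofBits = μ0 := by
  have hm : Measurable (fun x k => bit x k) := measurable_pi_lambda _ measurable_bit
  rw [← map_bits, Measure.map_map measurable_ofBits hm]
  conv_rhs => rw [← Measure.map_id (μ := μ0)]
  apply Measure.map_congr
  rw [μ0, ← Measure.restrict_congr_set Ico_ae_eq_Icc]
  filter_upwards [self_mem_ae_restrict measurableSet_Ico] with x hx
  exact ofBits_bit hx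

lemma map_uSlice : μ0.map (fun x i => uSlice x i) = Measure.infinitePi (fun _ : ℕ => μ0) := by
  have hm : Measurable (fun x k => bit x k) := measurable_pi_lambda _ measurable_bit
  have h1 : (Measure.infinitePi (fun _ : ℕ => coin)).map
      (fun ω (p : ℕ × ℕ) => ω (Nat.pairEquiv p)) = Measure.infinitePi (fun _ : ℕ × ℕ => coin) :=
    Measure.map_infinitePi_infinitePi_of_inj (P := fun _ => coin) Nat.pairEquiv.injective
  have h2 := Measure.infinitePi_map_curry (fun _ _ : ℕ => coin)
  have h3 := Measure.infinitePi_map_pi (fun _ : ℕ => Measure.infinitePi (fun _ : ℕ => coin))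
    (f := fun _ => ofBits) (fun _ => measurable_ofBits)
  have : ∀ i : ℕ, (fun _ : ℕ => (Measure.infinitePi (fun _ : ℕ => coin)).map ofBits) i = μ0 :=
    fun _ => map_ofBits
  simp only [map_ofBits] at h3
  have m3 : Measurable (fun (x : ℕ → ℕ → Bool) i => ofBits (x i)) :=
    measurable_pi_lambda _ fun i => measurable_ofBits.comp (measurable_pi_apply i)
  have m1 : Measurable (fun (ω : ℕ → Bool) (p : ℕ × ℕ) => ω (Nat.pairEquiv p)) := by fun_prop
  rw [← h3, ← h2, ← h1, ← map_bits, Measure.map_map m1 hm,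
    Measure.map_map (MeasurableEquiv.measurable _) (m1.comp hm),
    Measure.map_map m3 ((MeasurableEquiv.measurable _).comp (m1.comp hm))]
  rfl

end

end RW

namespace RW

noncomputable section

lemma measurable_pick {d : ℕ} (S : Finset (V d)) : Measurable (pick S) := by
  unfold pick
  by_cases h : S.Nonempty
  · simp only [h, dif_pos]
    exact (measurable_of_countable (fun z : ℤ => ((S.equivFin.symm ⟨z.toNat % S.card,
      Nat.mod_lt _ (Finset.card_pos.mpr h)⟩).val : V d))).comp
      (Int.measurable_floor.comp (measurable_id.mul_const _))
  · simp only [h, dif_neg, not_false_iff]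
    exact measurable_const

lemma pick_law {d : ℕ} (S : Finset (V d)) (e : V d) (he : e ∈ S) :
    μ0 {u | pick S u = e} = (S.card : ℝ≥0∞)⁻¹ := by
  have hne : S.Nonempty := ⟨e, he⟩
  have hN : 0 < S.card := Finset.card_pos.mpr hne
  set N := S.card with hNdef
  set k := S.equivFin ⟨e, he⟩ with hk
  have hNr : (0:ℝ) < N := by exact_mod_cast hN
  have hkN : (k : ℕ) < N := k.2
  have hset : Set.Ico (0:ℝ) 1 ∩ {u | pick S u = e} =
      Set.Ico ((k : ℕ) / N : ℝ) (((k : ℕ) + 1) / N) := by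
    ext u
    have key : ∀ u : ℝ, 0 ≤ u → u < 1 → (pick S u = e ↔ ⌊u * N⌋ = ((k : ℕ) : ℤ)) := by
      intro u h0 h1
      have hf0 : 0 ≤ ⌊u * N⌋ := Int.floor_nonneg.2 (by positivity)
      have hf1 : ⌊u * N⌋ < N := by
        rw [Int.floor_lt]; push_cast; nlinarith
      have hmod : ⌊u * N⌋.toNat % N = ⌊u * N⌋.toNat := Nat.mod_eq_of_lt (by omega)
      unfold pick
      rw [dif_pos hne]
      constructor
      · intro h
        have h' : S.equivFin.symm ⟨⌊u * N⌋.toNat % N, Nat.mod_lt _ hN⟩ = ⟨e, he⟩ :=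
          Subtype.ext h
        rw [Equiv.symm_apply_eq, ← hk] at h'
        have := congrArg Fin.val h'
        simp only [hmod] at this
        omega
      · intro h
        have h' : S.equivFin.symm ⟨⌊u * N⌋.toNat % N, Nat.mod_lt _ hN⟩ = ⟨e, he⟩ := by
          rw [Equiv.symm_apply_eq, ← hk]
          apply Fin.ext
          simp only [hmod]
          omega
        exact congrArg Subtype.val h'
    simp only [Set.mem_inter_iff, Set.mem_Ico, Set.mem_ofPred_eq]
    rw [div_le_iff₀ hNr, lt_div_iff₀ hNr]
    constructor
    · rintro ⟨⟨h0, h1⟩, h⟩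
      have := (key u h0 h1).1 h
      rw [Int.floor_eq_iff] at this
      simpa using this
    · rintro ⟨h0, h1⟩
      have hu0 : 0 ≤ u := by
        by_contra hc
        push Not at hc
        have : (0:ℝ) ≤ (k : ℕ) := by positivity
        nlinarith
      have hu1 : u < 1 := by
        by_contra hc
        push Not at hc
        have : ((k : ℕ) : ℝ) + 1 ≤ N := by exact_mod_cast hkN
        nlinarith
      refine ⟨⟨hu0, hu1⟩, (key u hu0 hu1).2 ?_⟩
      rw [Int.floor_eq_iff]
      simpa using ⟨h0, h1⟩
  rw [μ0, ← Measure.restrict_congr_set Ico_ae_eq_Icc, Measure.restrict_apply, Set.inter_comm, hset,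
    Real.volume_Ico]
  · rw [← sub_div, add_sub_cancel_left, one_div, ENNReal.ofReal_inv_of_pos hNr]
    simp
  · exact measurable_pick S (MeasurableSet.of_discrete (s := {e}))

/-- law of one step -/
def stepLaw (d : ℕ) : Measure (V d) := μ0.map (pick (unitVecs d))

instance (d : ℕ) : IsProbabilityMeasure (stepLaw d) :=
  Measure.isProbabilityMeasure_map (measurable_pick _).aemeasurable

/-- law of the step sequence -/
def seqLaw (d : ℕ) : Measure (ℕ → V d) := Measure.infinitePi (fun _ => stepLaw d)

instance (d : ℕ) : IsProbabilityMeasure (seqLaw d) := by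
  unfold seqLaw; infer_instance

lemma measurable_uSlice : Measurable (fun x i => uSlice x i) := by
  have : (fun x i => uSlice x i) = fun x i => ofBits (fun j => bit x (Nat.pair i j)) := rfl
  rw [this]
  exact measurable_pi_lambda _ fun i => measurable_ofBits.comp
    (measurable_pi_lambda _ fun j => measurable_bit _)

/-- the step sequence -/
def steps (d : ℕ) (ω : ℝ) (i : ℕ) : V d := pick (unitVecs d) (uSlice ω i)

lemma measurable_steps (d : ℕ) : Measurable (steps d) :=
  measurable_pi_lambda _ fun i => (measurable_pick _).comp
    ((measurable_pi_apply i).comp measurable_uSlice)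

lemma map_steps (d : ℕ) : μ0.map (steps d) = seqLaw d := by
  have h := Measure.infinitePi_map_pi (fun _ : ℕ => μ0)
    (f := fun _ => pick (unitVecs d)) (fun _ => measurable_pick _)
  rw [seqLaw]
  unfold stepLaw
  rw [← h, ← map_uSlice, Measure.map_map _ measurable_uSlice]
  · rfl
  · exact measurable_pi_lambda _ fun i => (measurable_pick _).comp (measurable_pi_apply i)

/-- prepend -/
def consSeq {d : ℕ} (p : V d × (ℕ → V d)) : ℕ → V d
  | 0 => p.1
  | k + 1 => p.2 k

lemma measurable_consSeq {d : ℕ} : Measurable (consSeq (d := d)) := by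
  refine measurable_pi_lambda _ fun i => ?_
  rcases i with _ | i
  · exact measurable_fst
  · exact (measurable_pi_apply i).comp measurable_snd

lemma map_cons (d : ℕ) : ((stepLaw d).prod (seqLaw d)).map consSeq = seqLaw d := by
  classical
  apply Measure.eq_infinitePi
  intro s t ht
  rw [Measure.map_apply measurable_consSeq (MeasurableSet.pi s.countable_toSet (fun i _ => ht i))]
  set t' : ℕ → Set (V d) := fun k => if k ∈ s then t k else Set.univ with ht'
  obtain ⟨n, hn⟩ : ∃ n, s ⊆ Finset.range n := s.exists_nat_subset_range
  have hn' : s ⊆ Finset.range (n + 1) := hn.trans (Finset.range_mono (Nat.le_succ n))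
  have e1 : ∏ k ∈ Finset.range (n + 1), stepLaw d (t' k) = ∏ k ∈ s, stepLaw d (t k) := by
    rw [← Finset.prod_subset hn']
    · exact Finset.prod_congr rfl (fun k hk => by simp [ht', hk])
    · intro k _ hk; simp [ht', hk]
  have e2 : consSeq ⁻¹' (Set.pi s t) =
      (t' 0) ×ˢ (Set.pi (Finset.range n) (fun k => t' (k + 1))) := by
    ext p
    simp only [Set.mem_preimage, Set.mem_pi, Set.mem_prod, Finset.mem_coe, ht']
    constructor
    · intro h
      constructor
      · split_ifs with h0
        · exact h 0 h0
        · trivial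
      · intro k _
        split_ifs with h0
        · exact h _ h0
        · trivial
    · rintro ⟨h0, h⟩ k hk
      rcases k with _ | k
      · rw [if_pos hk] at h0; exact h0
      · have hk' : k ∈ Finset.range n := by
          have := Finset.mem_range.1 (hn hk)
          exact Finset.mem_range.2 (by omega)
        have h3 := h k hk'
        rw [if_pos hk] at h3; exact h3
  rw [e2, Measure.prod_prod, ← e1, Finset.prod_range_succ', mul_comm, seqLaw,
    Measure.infinitePi_pi]
  intro k _
  exact MeasurableSet.of_discrete

/-- partial sums -/
def path {d : ℕ} (x : V d) (s : ℕ → V d) (t : ℕ) : V d := x + ∑ i ∈ Finset.range t, s i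

lemma path_cons {d : ℕ} (x : V d) (p : V d × (ℕ → V d)) (t : ℕ) :
    path x (consSeq p) (t + 1) = path (x + p.1) p.2 t := by
  unfold path
  rw [Finset.sum_range_succ', add_assoc, add_comm p.1]
  rfl

/-- exit event -/
def exitEv {d : ℕ} (A : Finset (V d)) (y x : V d) : Set (ℕ → V d) :=
  {s | ∃ t, path x s t = y ∧ ∀ r < t, path x s r ∈ A}

lemma hitPt_iff {d : ℕ} (A : Finset (V d)) (x y : V d) (hy : y ∉ A) (ω : ℝ) :
    hitPt A x ω = y ↔ steps d ω ∈ exitEv A y x := by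
  have hw : ∀ t, walk x ω t = path x (steps d ω) t := fun t => rfl
  unfold hitPt exitT exitEv
  simp only [hw, Set.mem_ofPred_eq]
  constructor
  · intro h
    refine ⟨_, h, fun r hr => ?_⟩
    by_contra hc
    exact absurd (Nat.sInf_le (s := {t | path x (steps d ω) t ∉ A}) hc) (by omega)
  · rintro ⟨t, h1, h2⟩
    have : sInf {t | path x (steps d ω) t ∉ A} = t := by
      apply le_antisymm
      · apply Nat.sInf_le
        show path x (steps d ω) t ∉ A
        rw [h1]; exact hy
      · apply le_csInf
        · exact ⟨t, by show path x (steps d ω) t ∉ A; rw [h1]; exact hy⟩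
        · intro r hr
          by_contra hc
          push Not at hc
          exact hr (h2 r hc)
    rw [this, h1]

lemma measurable_path {d : ℕ} (x : V d) (t : ℕ) : Measurable (fun s => path x s t) := by
  unfold path
  exact measurable_const.add (Finset.measurable_sum _ fun i _ => measurable_pi_apply i)

lemma measurableSet_exitEv {d : ℕ} (A : Finset (V d)) (y x : V d) :
    MeasurableSet (exitEv A y x) := by
  have : exitEv A y x = ⋃ t, ((fun s => path x s t) ⁻¹' {y} ∩
      ⋂ r ∈ Set.Iio t, (fun s => path x s r) ⁻¹' (A : Set (V d))) := by
    ext s; simp [exitEv]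
  rw [this]
  refine MeasurableSet.iUnion fun t => MeasurableSet.inter ?_ ?_
  · exact measurable_path x t MeasurableSet.of_discrete
  · exact MeasurableSet.biInter (Set.to_countable _)
      fun r _ => measurable_path x r MeasurableSet.of_discrete

lemma hitProb_eq {d : ℕ} (A : Finset (V d)) (x y : V d) (hy : y ∉ A) :
    hitProb A x y = seqLaw d (exitEv A y x) := by
  rw [hitProb, ← map_steps, Measure.map_apply (measurable_steps d) (measurableSet_exitEv A y x)]
  congr 1
  ext ω
  exact hitPt_iff A x y hy ω

lemma exitEv_cons {d : ℕ} (A : Finset (V d)) (x y : V d) (hx : x ∈ A) (hy : y ∉ A)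
    (p : V d × (ℕ → V d)) : consSeq p ∈ exitEv A y x ↔ p.2 ∈ exitEv A y (x + p.1) := by
  have h0 : ∀ s : ℕ → V d, path x s 0 = x := fun s => by simp [path]
  unfold exitEv
  simp only [Set.mem_ofPred_eq]
  constructor
  · rintro ⟨t, h1, h2⟩
    rcases t with _ | t
    · rw [h0] at h1; exact absurd (h1 ▸ hx) hy
    · refine ⟨t, by rw [← path_cons, h1], fun r hr => ?_⟩
      rw [← path_cons]; exact h2 _ (by omega)
  · rintro ⟨t, h1, h2⟩
    refine ⟨t + 1, by rw [path_cons, h1], fun r hr => ?_⟩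
    rcases r with _ | r
    · rw [h0]; exact hx
    · rw [path_cons]; exact h2 _ (by omega)

lemma hitProb_harm {d : ℕ} (hd : 0 < d) (A : Finset (V d)) (x y : V d) (hx : x ∈ A) (hy : y ∉ A) :
    hitProb A x y = ∑ e ∈ unitVecs d, ((unitVecs d).card : ℝ≥0∞)⁻¹ * hitProb A (x + e) y := by
  have hm := measurableSet_exitEv A y x
  have h1 : seqLaw d (exitEv A y x) = ∫⁻ e, seqLaw d (exitEv A y (x + e)) ∂(stepLaw d) := by
    conv_lhs => rw [← map_cons d]
    rw [Measure.map_apply measurable_consSeq hm, Measure.prod_apply (measurable_consSeq hm)]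
    congr 1
    ext e
    congr 1
    ext s
    exact exitEv_cons A x y hx hy (e, s)
  have hne : (unitVecs d).Nonempty := by
    unfold unitVecs
    exact Finset.image_nonempty.2 ⟨(⟨0, hd⟩, true), Finset.mem_univ _⟩
  have hmem : ∀ u, pick (unitVecs d) u ∈ unitVecs d := by
    intro u; unfold pick; rw [dif_pos hne]; exact Subtype.property _
  rw [hitProb_eq A x y hy, h1]
  have h2 : stepLaw d = (stepLaw d).restrict (unitVecs d : Set (V d)) := by
    rw [Measure.restrict_eq_self_of_ae_mem]
    unfold stepLaw
    rw [ae_map_iff (measurable_pick _).aemeasurable MeasurableSet.of_discrete]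
    exact Filter.Eventually.of_forall hmem
  rw [h2, lintegral_finset]
  refine Finset.sum_congr rfl fun e he => ?_
  rw [hitProb_eq A _ y hy, mul_comm, stepLaw, Measure.map_apply (measurable_pick _)
    MeasurableSet.of_discrete]
  congr 1
  exact pick_law _ e he

/-- indexed unit vectors -/
def uv (d : ℕ) (p : Fin d × Bool) : V d :=
  fun j => if j = p.1 then (if p.2 then 1 else -1) else 0

lemma uv_inj (d : ℕ) : Function.Injective (uv d) := by
  rintro ⟨i, b⟩ ⟨j, c⟩ h
  have h1 := congrFun h i
  simp only [uv, if_true] at h1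
  by_cases hij : i = j
  · subst hij
    cases b <;> cases c <;> simp at h1 ⊢
  · rw [if_neg hij] at h1
    cases b <;> simp at h1

lemma h_harm {d : ℕ} (hd : 0 < d) (A : Finset (V d)) (x y : V d) (hx : x ∈ A) (hy : y ∉ A) :
    ∑ p, (hitProb A (x + uv d p) y).toReal = 2 * d * (hitProb A x y).toReal := by
  have hfin : ∀ z, hitProb A z y ≠ ⊤ := fun z => measure_ne_top μ0 _
  have himg : unitVecs d = Finset.image (uv d) Finset.univ := rfl
  have hcard : (unitVecs d).card = 2 * d := by
    rw [himg, Finset.card_image_of_injective _ (uv_inj d)]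
    simp [mul_comm]
  have h := hitProb_harm hd A x y hx hy
  rw [hcard, ← Finset.mul_sum] at h
  rw [himg, Finset.sum_image (fun a _ b _ hab => uv_inj d hab)] at h
  have hr := congrArg ENNReal.toReal h
  rw [ENNReal.toReal_mul, ENNReal.toReal_sum (fun z _ => hfin _)] at hr
  rw [hr]
  have : (d : ℝ) ≠ 0 := by positivity
  simp
  field_simp

end

end RW

namespace RW

noncomputable section

lemma pair_ineq {x y : ℝ} (hx : 0 < x) (hy : 0 < y) :
    (max 0 (1 - (x + y) / 2)) ^ 2 ≤ (1 - x * y) ^ 2 * ((1 / x + 1 / y) / 2) := by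
  rcases le_total (1 - (x + y) / 2) 0 with h | h
  · rw [max_eq_left h]
    have : 0 ≤ (1 / x + 1 / y) / 2 := by positivity
    have := mul_nonneg (sq_nonneg (1 - x * y)) this
    simpa using this
  · rw [max_eq_right h]
    have hp : x * y ≤ ((x + y) / 2) ^ 2 := by nlinarith [sq_nonneg (x - y)]
    have hm : ((x + y) / 2) ^ 2 ≤ (x + y) / 2 := by nlinarith
    have h1 : 1 ≤ (1 / x + 1 / y) / 2 := by
      have : (1 / x + 1 / y) / 2 = ((x + y) / 2) / (x * y) := by field_simp; ring
      rw [this, le_div_iff₀ (by positivity)]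
      linarith
    have h2 : (1 - (x + y) / 2) ^ 2 ≤ (1 - x * y) ^ 2 := by
      apply pow_le_pow_left₀ h
      linarith
    calc (1 - (x + y) / 2) ^ 2 ≤ (1 - x * y) ^ 2 * 1 := by linarith
      _ ≤ _ := mul_le_mul_of_nonneg_left h1 (sq_nonneg _)

/-- Bochner-type inequality at a point. -/
lemma bochner {ι : Type*} [Fintype ι] (neg : ι → ι) (hneg : Function.Involutive neg)
    (N : ℝ) (hN : N = Fintype.card ι) (a : ι → ℝ) (ha : ∀ i, 0 < a i) (b : ι → ι → ℝ)
    (hb1 : ∀ i, b i (neg i) = 1) (hsymm : ∀ i j, b i j = b j i)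
    (ha2 : ∑ i, a i ^ 2 = N) (hb2 : ∀ i, ∑ j, b i j ^ 2 = N * a i ^ 2)
    (hle : 0 ≤ N - ∑ i, a i) :
    (N - ∑ i, a i) ^ 2 ≤ 2 * N * (N * ∑ i, a i - ∑ i, ∑ j, a i * b i j) := by
  have hN0 : 0 ≤ N := by rw [hN]; positivity
  have hrow : ∀ i, ∑ j, (b i j - a i * a j) ^ 2 / a i = 2 * N * a i - 2 * ∑ j, a j * b j i := by
    intro i
    have hi := (ha i).ne'
    have : ∀ j, (b i j - a i * a j) ^ 2 / a i
        = (b i j ^ 2) / a i - 2 * (a j * b j i) + a i * a j ^ 2 := by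
      intro j
      rw [hsymm j i]
      field_simp
      ring
    simp only [this]
    rw [Finset.sum_add_distrib, Finset.sum_sub_distrib, ← Finset.sum_div, hb2, ← Finset.mul_sum,
      ← Finset.mul_sum, ha2]
    field_simp
    ring
  have htot : ∑ i, ∑ j, (b i j - a i * a j) ^ 2 / a i
      = 2 * (N * ∑ i, a i - ∑ i, ∑ j, a i * b i j) := by
    simp only [hrow]
    rw [Finset.sum_sub_distrib, ← Finset.mul_sum, ← Finset.mul_sum, Finset.sum_comm]
    ring
  have hdrop : ∑ i, (1 - a i * a (neg i)) ^ 2 / a i ≤ ∑ i, ∑ j, (b i j - a i * a j) ^ 2 / a i := by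
    refine Finset.sum_le_sum fun i _ => ?_
    have := Finset.single_le_sum (f := fun j => (b i j - a i * a j) ^ 2 / a i)
      (fun j _ => div_nonneg (sq_nonneg _) (ha i).le) (Finset.mem_univ (neg i))
    simpa [hb1] using this
  have hinv : ∀ f : ι → ℝ, ∑ i, f (neg i) = ∑ i, f i := fun f =>
    Equiv.sum_comp (hneg.toPerm neg) f
  set t : ι → ℝ := fun i => max 0 (1 - (a i + a (neg i)) / 2) with ht
  have hsum : N - ∑ i, a i = ∑ i, (1 - (a i + a (neg i)) / 2) := by
    rw [Finset.sum_sub_distrib, ← Finset.sum_div, Finset.sum_add_distrib, hinv, hN]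
    simp
  have hw : N - ∑ i, a i ≤ ∑ i, t i := by
    rw [hsum]; exact Finset.sum_le_sum fun i _ => le_max_right _ _
  have hw2 : (N - ∑ i, a i) ^ 2 ≤ N * ∑ i, t i ^ 2 := by
    calc (N - ∑ i, a i) ^ 2 ≤ (∑ i, t i) ^ 2 := by gcongr
      _ ≤ (Finset.univ : Finset ι).card * ∑ i, t i ^ 2 := sq_sum_le_card_mul_sum_sq
      _ = N * ∑ i, t i ^ 2 := by rw [hN]; rfl
  have hsymsum : ∑ i, (1 - a i * a (neg i)) ^ 2 / a i
      = ∑ i, (1 - a i * a (neg i)) ^ 2 * ((1 / a i + 1 / a (neg i)) / 2) := by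
    have h1 := hinv (fun i => (1 - a i * a (neg i)) ^ 2 / a i)
    have h2 : ∑ i, (1 - a i * a (neg i)) ^ 2 * ((1 / a i + 1 / a (neg i)) / 2)
        = (∑ i, (1 - a i * a (neg i)) ^ 2 / a i
          + ∑ i, (1 - a (neg i) * a (neg (neg i))) ^ 2 / a (neg i)) / 2 := by
      rw [← Finset.sum_add_distrib, Finset.sum_div]
      refine Finset.sum_congr rfl fun i _ => ?_
      rw [hneg i]
      ring
    rw [h2, h1]; ring
  have hpt : ∀ i, t i ^ 2 ≤ (1 - a i * a (neg i)) ^ 2 * ((1 / a i + 1 / a (neg i)) / 2) := by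
    intro i
    exact pair_ineq (ha i) (ha (neg i))
  calc (N - ∑ i, a i) ^ 2 ≤ N * ∑ i, t i ^ 2 := hw2
    _ ≤ N * ∑ i, (1 - a i * a (neg i)) ^ 2 / a i := by
        rw [hsymsum]
        exact mul_le_mul_of_nonneg_left (Finset.sum_le_sum fun i _ => hpt i) hN0
    _ ≤ N * (2 * (N * ∑ i, a i - ∑ i, ∑ j, a i * b i j)) := by
        rw [← htot]; exact mul_le_mul_of_nonneg_left hdrop hN0
    _ = _ := by ring

lemma max_est {ι : Type*} [Fintype ι] (N R ψ w : ℝ) (hN : N = Fintype.card ι) (hN1 : 1 ≤ N)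
    (hR : 1 ≤ R)
    (a wi c : ι → ℝ) (ha2 : ∑ i, a i ^ 2 = N) (hw : w = N - ∑ i, a i)
    (hboch : w ^ 2 ≤ 2 * N * ∑ i, a i ^ 2 * (wi i - w))
    (hψ : 6 * R ≤ ψ) (hψ2 : ψ ≤ R ^ 2) (hc : ∀ i, |c i| ≤ R) (hc0 : ∑ i, c i = 0)
    (hmax : ∀ i, (ψ - (2 * c i + 1)) ^ 2 * wi i ≤ ψ ^ 2 * w) :
    ψ ^ 2 * w ≤ 1100 * N ^ 3 * R ^ 2 := by
  have hR0 : 0 < R := by linarith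
  have hψ0 : 0 < ψ := by linarith
  have hsqm : ∑ i, (a i - 1) ^ 2 = 2 * w := by
    have : ∀ i, (a i - 1) ^ 2 = a i ^ 2 - 2 * a i + 1 := fun i => by ring
    simp only [this]
    rw [Finset.sum_add_distrib, Finset.sum_sub_distrib, ha2, ← Finset.mul_sum, hw]
    simp [← hN]; ring
  have hw0 : 0 ≤ w := by
    have : 0 ≤ ∑ i, (a i - 1) ^ 2 := Finset.sum_nonneg fun i _ => sq_nonneg _
    linarith
  rcases hw0.eq_or_lt with h0 | hwpos
  · rw [← h0]; simp; positivity
  have hsqp : ∑ i, (a i + 1) ^ 2 ≤ 4 * N := by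
    have : ∀ i, (a i + 1) ^ 2 = 2 * a i ^ 2 + 2 - (a i - 1) ^ 2 := fun i => by ring
    simp only [this]
    rw [Finset.sum_sub_distrib, Finset.sum_add_distrib, ← Finset.mul_sum, ha2, hsqm]
    simp [← hN]; linarith
  have hδ : ∀ i, |2 * c i + 1| ≤ 3 * R := by
    intro i
    have := abs_le.1 (hc i)
    rw [abs_le]; constructor <;> linarith
  -- pointwise comparison
  have hpt : ∀ i, ψ ^ 2 * (wi i - w) ≤ w * (2 * (2 * c i + 1) * ψ + 144 * R ^ 2) := by
    intro i
    have h1 := hmax i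
    have h2 := abs_le.1 (hδ i)
    generalize 2 * c i + 1 = δ at *
    have hlo : -(ψ / 2) ≤ δ := by linarith
    have hhi : δ ≤ ψ / 2 := by linarith
    have hpos : 0 < ψ - δ := by linarith
    have hpoly : ψ ^ 2 * (ψ ^ 2 - (ψ - δ) ^ 2) ≤ (ψ - δ) ^ 2 * (2 * δ * ψ + 16 * δ ^ 2) := by
      have : (ψ - δ) ^ 2 * (2 * δ * ψ + 16 * δ ^ 2) - ψ ^ 2 * (ψ ^ 2 - (ψ - δ) ^ 2)
        = δ ^ 2 * (13 * ψ ^ 2 - 30 * δ * ψ + 16 * δ ^ 2) := by ring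
      have h3 : 0 ≤ 13 * ψ ^ 2 - 30 * δ * ψ + 16 * δ ^ 2 := by
        nlinarith [sq_nonneg (ψ / 2 - δ), mul_nonneg (sub_nonneg.2 hhi) hψ0.le]
      nlinarith [mul_nonneg (sq_nonneg δ) h3]
    have h4 : (ψ - δ) ^ 2 * (ψ ^ 2 * (wi i - w)) ≤
        (ψ - δ) ^ 2 * (w * (2 * δ * ψ + 16 * δ ^ 2)) := by
      have e1 := mul_le_mul_of_nonneg_left h1 (sq_nonneg ψ)
      have e2 := mul_le_mul_of_nonneg_left hpoly hw0
      linarith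
    have h5 := le_of_mul_le_mul_left h4 (by positivity)
    have h6 : δ ^ 2 ≤ 9 * R ^ 2 := by nlinarith
    refine h5.trans (mul_le_mul_of_nonneg_left ?_ hw0)
    linarith
  set T := ∑ i, a i ^ 2 * c i with hT
  have hTeq : T = ∑ i, (a i - 1) * ((a i + 1) * c i) := by
    have : ∀ i, (a i - 1) * ((a i + 1) * c i) = a i ^ 2 * c i - c i := fun i => by ring
    simp only [this]
    rw [Finset.sum_sub_distrib, hc0, sub_zero]
  have hT2 : T ^ 2 ≤ 8 * N * R ^ 2 * w := by
    rw [hTeq]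
    refine (Finset.sum_mul_sq_le_sq_mul_sq _ _ _).trans ?_
    rw [hsqm]
    have : ∑ i, ((a i + 1) * c i) ^ 2 ≤ 4 * N * R ^ 2 := by
      calc ∑ i, ((a i + 1) * c i) ^ 2 ≤ ∑ i, (a i + 1) ^ 2 * R ^ 2 := by
            refine Finset.sum_le_sum fun i _ => ?_
            rw [mul_pow]
            exact mul_le_mul_of_nonneg_left (sq_le_sq' (abs_le.1 (hc i)).1 (abs_le.1 (hc i)).2)
              (sq_nonneg _)
        _ = (∑ i, (a i + 1) ^ 2) * R ^ 2 := by rw [Finset.sum_mul]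
        _ ≤ _ := by gcongr
    have := mul_le_mul_of_nonneg_left this (by linarith : (0:ℝ) ≤ 2 * w)
    linarith
  have hsum : ψ ^ 2 * ∑ i, a i ^ 2 * (wi i - w) ≤
      w * (4 * ψ * T + 2 * N * ψ + 144 * N * R ^ 2) := by
    have e : w * (4 * ψ * T + 2 * N * ψ + 144 * N * R ^ 2)
        = ∑ i, a i ^ 2 * (w * (2 * (2 * c i + 1) * ψ + 144 * R ^ 2)) := by
      have : ∀ i, a i ^ 2 * (w * (2 * (2 * c i + 1) * ψ + 144 * R ^ 2))
        = (w * 4 * ψ) * (a i ^ 2 * c i) + (w * (2 * ψ + 144 * R ^ 2)) * a i ^ 2 := fun i => by ring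
      simp only [this]
      rw [Finset.sum_add_distrib, ← Finset.mul_sum, ← Finset.mul_sum, ha2, ← hT]
      ring
    rw [e, Finset.mul_sum]
    refine Finset.sum_le_sum fun i _ => ?_
    have := mul_le_mul_of_nonneg_left (hpt i) (sq_nonneg (a i))
    linarith
  have hmain : w * (ψ ^ 2 * w) ≤ w * (2 * N * (4 * ψ * T + 2 * N * ψ + 144 * N * R ^ 2)) := by
    have e1 := mul_le_mul_of_nonneg_left hboch (sq_nonneg ψ)
    have e2 := mul_le_mul_of_nonneg_left hsum (by linarith : (0:ℝ) ≤ 2 * N)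
    linarith
  have hW := le_of_mul_le_mul_left hmain hwpos
  set W := ψ ^ 2 * w with hWdef
  set X := ψ * T with hX
  have hX2 : X ^ 2 ≤ 8 * N * R ^ 2 * W := by
    rw [hX, hWdef, mul_pow]
    have := mul_le_mul_of_nonneg_left hT2 (sq_nonneg ψ)
    linarith
  have hW1 : W ≤ 8 * N * X + 292 * N ^ 2 * R ^ 2 := by
    have : 4 * N ^ 2 * ψ ≤ 4 * N ^ 2 * R ^ 2 := by gcongr
    have e : 2 * N * (4 * ψ * T + 2 * N * ψ + 144 * N * R ^ 2)
      = 8 * N * X + 4 * N ^ 2 * ψ + 288 * N ^ 2 * R ^ 2 := by rw [hX]; ring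
    linarith
  have hNR : 0 < N * R ^ 2 := by positivity
  have hAM : 8 * N * X ≤ W / 2 + 256 * N ^ 3 * R ^ 2 := by
    have h1 : 0 ≤ (X - 64 * N ^ 2 * R ^ 2) ^ 2 := sq_nonneg _
    have h2 : 128 * N ^ 2 * R ^ 2 * X ≤ 8 * N * R ^ 2 * W + 4096 * N ^ 4 * R ^ 4 := by linarith
    have h3 : (16 * (N * R ^ 2)) * (8 * N * X) ≤
        (16 * (N * R ^ 2)) * (W / 2 + 256 * N ^ 3 * R ^ 2) := by linarith
    exact le_of_mul_le_mul_left h3 (by positivity)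
  have hN32 : N ^ 2 * R ^ 2 ≤ N ^ 3 * R ^ 2 := by
    have : N ^ 2 ≤ N ^ 3 := pow_le_pow_right₀ hN1 (by norm_num)
    gcongr
  have hnn : 0 ≤ N ^ 3 * R ^ 2 := by positivity
  linarith

end

end RW

namespace RW

noncomputable section

/-- squared Euclidean norm -/
def nsq {d : ℕ} (z : V d) : ℝ := ∑ i, (z i : ℝ) ^ 2

lemma nsq_nonneg {d : ℕ} (z : V d) : 0 ≤ nsq z := Finset.sum_nonneg fun i _ => sq_nonneg _

lemma coord_sq_le {d : ℕ} (z : V d) (i : Fin d) : (z i : ℝ) ^ 2 ≤ nsq z :=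
  Finset.single_le_sum (f := fun i => (z i : ℝ) ^ 2) (fun i _ => sq_nonneg _) (Finset.mem_univ i)

lemma coord_abs_le {d : ℕ} {z : V d} {r : ℝ} (hr : 0 ≤ r) (h : nsq z ≤ r ^ 2) (i : Fin d) :
    |(z i : ℝ)| ≤ r := abs_le_of_sq_le_sq ((coord_sq_le z i).trans h) hr

lemma mem_ball_iff {d : ℕ} {r : ℝ} (hr : 0 ≤ r) (z : V d) : z ∈ ball d r ↔ nsq z ≤ r ^ 2 := by
  classical
  have key : Real.sqrt (∑ i, ((z i : ℝ)) ^ 2) ≤ r ↔ nsq z ≤ r ^ 2 := Real.sqrt_le_left hr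
  unfold ball
  rw [Finset.mem_filter, key, and_iff_right_iff_imp]
  intro h
  rw [Finset.mem_Icc]
  constructor
  · intro i
    have h1 := (abs_le.1 (coord_abs_le hr h i)).1
    have h2 := Int.le_ceil r
    have : ((-⌈r⌉ : ℤ) : ℝ) ≤ z i := by push_cast; linarith
    exact_mod_cast this
  · intro i
    have h1 := (abs_le.1 (coord_abs_le hr h i)).2
    have h2 := Int.le_ceil r
    have : (z i : ℝ) ≤ (⌈r⌉ : ℤ) := by linarith
    exact_mod_cast this

/-- the inner product of a point with a unit vector -/
def cc {d : ℕ} (z : V d) (p : Fin d × Bool) : ℝ := if p.2 then (z p.1 : ℝ) else -(z p.1 : ℝ)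

lemma nsq_add_uv {d : ℕ} (z : V d) (p : Fin d × Bool) :
    nsq (z + uv d p) = nsq z + (2 * cc z p + 1) := by
  obtain ⟨i, b⟩ := p
  have : ∀ j, (((z + uv d (i, b)) j : ℤ) : ℝ) ^ 2
      = (z j : ℝ) ^ 2 + if j = i then 2 * cc z (i, b) + 1 else 0 := by
    intro j
    by_cases h : j = i
    · subst h
      cases b <;> simp [uv, cc] <;> ring
    · simp [uv, h]
  unfold nsq
  simp only [this]
  rw [Finset.sum_add_distrib]
  simp

lemma sum_cc {d : ℕ} (z : V d) : ∑ p, cc z p = 0 := by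
  rw [Fintype.sum_prod_type]
  simp [cc]

/-- opposite direction -/
def opp {d : ℕ} (p : Fin d × Bool) : Fin d × Bool := (p.1, !p.2)

lemma opp_inv {d : ℕ} : Function.Involutive (opp (d := d)) := by
  rintro ⟨i, b⟩; simp [opp]

lemma uv_opp {d : ℕ} (p : Fin d × Bool) : uv d p + uv d (opp p) = 0 := by
  obtain ⟨i, b⟩ := p
  ext j
  by_cases h : j = i <;> cases b <;> simp [uv, opp, h]

/-- the logarithmic-gradient-type quantity -/
def ww {d : ℕ} (v : V d → ℝ) (z : V d) : ℝ := 2 * d - ∑ p, v (z + uv d p) / v z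

lemma ratio_sq {d : ℕ} (v : V d → ℝ) (hv : ∀ z, 0 < v z) (z : V d)
    (hz : ∑ p, v (z + uv d p) ^ 2 = 2 * d * v z ^ 2) :
    ∑ p, (v (z + uv d p) / v z) ^ 2 = 2 * d := by
  have h := hv z
  simp only [div_pow]
  rw [← Finset.sum_div, hz]
  field_simp

lemma card_idx (d : ℕ) : (2 * d : ℝ) = Fintype.card (Fin d × Bool) := by
  simp [mul_comm]

lemma ratio_sub_sq {d : ℕ} (v : V d → ℝ) (hv : ∀ z, 0 < v z) (z : V d)
    (hz : ∑ p, v (z + uv d p) ^ 2 = 2 * d * v z ^ 2) :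
    ∑ p, (v (z + uv d p) / v z - 1) ^ 2 = 2 * ww v z := by
  have : ∀ p, (v (z + uv d p) / v z - 1) ^ 2 = (v (z + uv d p) / v z) ^ 2
    - 2 * (v (z + uv d p) / v z) + 1 := fun i => by ring
  simp only [this]
  rw [Finset.sum_add_distrib, Finset.sum_sub_distrib, ratio_sq v hv z hz, ← Finset.mul_sum, ww]
  have := card_idx d
  simp only [Finset.sum_const, Finset.card_univ, nsmul_eq_mul, mul_one, ← this]
  ring

lemma grad_est {d : ℕ} (hd : 1 ≤ d) (n : ℕ) (hn : 1 ≤ n) (v : V d → ℝ) (hv : ∀ z, 0 < v z)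
    (hharm : ∀ z ∈ ball d n, ∑ p, v (z + uv d p) ^ 2 = 2 * d * v z ^ 2) :
    ∀ z ∈ ball d n, ((n : ℝ) ^ 2 - nsq z) ^ 2 * ww v z ≤ 1100 * (2 * d) ^ 3 * n ^ 2 := by
  have hn1 : (1:ℝ) ≤ n := by exact_mod_cast hn
  have hd1 : (1:ℝ) ≤ d := by exact_mod_cast hd
  have hn0 : (0:ℝ) ≤ n := by linarith
  set F : V d → ℝ := fun z => ((n : ℝ) ^ 2 - nsq z) ^ 2 * ww v z with hF
  have hne : (ball d n).Nonempty := ⟨0, by rw [mem_ball_iff hn0]; simp [nsq]⟩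
  obtain ⟨x, hx, hmax⟩ := Finset.exists_max_image (ball d n) F hne
  intro z hz
  refine (hmax z hz).trans ?_
  have hxn := (mem_ball_iff hn0 x).1 hx
  set ψ := (n : ℝ) ^ 2 - nsq x with hψ
  have hψ0 : 0 ≤ ψ := by linarith
  have hw0 : 0 ≤ ww v x := by
    have h1 := ratio_sub_sq v hv x (hharm x hx)
    have : 0 ≤ ∑ p, (v (x + uv d p) / v x - 1) ^ 2 := Finset.sum_nonneg fun i _ => sq_nonneg _
    linarith
  have hwN : ww v x ≤ 2 * d := by
    unfold ww
    have : 0 ≤ ∑ p, v (x + uv d p) / v x :=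
      Finset.sum_nonneg fun i _ => (div_pos (hv _) (hv _)).le
    linarith
  show ψ ^ 2 * ww v x ≤ _
  by_cases hcase : ψ < 6 * n
  · have h1 : ψ ^ 2 ≤ 36 * n ^ 2 := by nlinarith
    have h2 : ψ ^ 2 * ww v x ≤ 36 * n ^ 2 * (2 * d) := mul_le_mul h1 hwN hw0 (by positivity)
    have h3 : (2 * (d:ℝ)) ≤ (2 * d) ^ 3 := le_self_pow₀ (by linarith) (by norm_num)
    have h4 : 36 * (n:ℝ) ^ 2 * (2 * d) ≤ 36 * n ^ 2 * (2 * d) ^ 3 := by gcongr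
    have h5 : 0 ≤ (n:ℝ) ^ 2 * (2 * d) ^ 3 := by positivity
    linarith
  · push Not at hcase
    have hc : ∀ p, |cc x p| ≤ n := by
      intro p
      have := coord_abs_le hn0 hxn p.1
      unfold cc
      split_ifs
      · exact this
      · rwa [abs_neg]
    have hψp : ∀ p, (n : ℝ) ^ 2 - nsq (x + uv d p) = ψ - (2 * cc x p + 1) := by
      intro p; rw [nsq_add_uv, hψ]; ring
    have hin : ∀ p, x + uv d p ∈ ball d n := by
      intro p
      rw [mem_ball_iff hn0]
      have h1 := hψp p
      have h2 := (abs_le.1 (hc p)).2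
      linarith
    refine max_est (ι := Fin d × Bool) (2 * d) n ψ (ww v x) (card_idx d) (by linarith) hn1
      (fun p => v (x + uv d p) / v x) (fun p => ww v (x + uv d p)) (cc x)
      (ratio_sq v hv x (hharm x hx)) rfl ?_ hcase ?_ hc (sum_cc x) ?_
    · have hb := bochner (ι := Fin d × Bool) opp opp_inv (2 * d) (card_idx d)
        (fun p => v (x + uv d p) / v x) (fun p => div_pos (hv _) (hv _))
        (fun p q => v (x + uv d p + uv d q) / v x)
        (fun p => by rw [add_assoc, uv_opp, add_zero, div_self (hv x).ne'])
        (fun p q => by rw [add_right_comm])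
        (ratio_sq v hv x (hharm x hx))
        (fun p => by
          simp only [div_pow]
          rw [← Finset.sum_div, hharm _ (hin p)]; ring)
        hw0
      refine hb.trans (le_of_eq ?_)
      congr 1
      have hx0 := (hv x).ne'
      have e1 : ∀ p, (v (x + uv d p) / v x) ^ 2 * (ww v (x + uv d p) - ww v x)
          = (2 * d - ww v x) * (v (x + uv d p) / v x) ^ 2
            - ∑ q, v (x + uv d p) / v x * (v (x + uv d p + uv d q) / v x) := by
        intro p
        have hp0 := (hv (x + uv d p)).ne'
        have : (v (x + uv d p) / v x) ^ 2 * ∑ q, v (x + uv d p + uv d q) / v (x + uv d p)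
            = ∑ q, v (x + uv d p) / v x * (v (x + uv d p + uv d q) / v x) := by
          rw [Finset.mul_sum]
          refine Finset.sum_congr rfl fun q _ => ?_
          field_simp
        rw [← this]
        conv_lhs => rw [ww]
        ring
      simp only [e1]
      rw [Finset.sum_sub_distrib, ← Finset.mul_sum, ratio_sq v hv x (hharm x hx)]
      rw [ww]; ring
    · have := nsq_nonneg x
      linarith
    · intro p
      rw [← hψp]
      exact hmax _ (hin p)

lemma step_est {d : ℕ} (hd : 1 ≤ d) (n : ℕ) (hn : 1 ≤ n) (u : V d → ℝ) (hu : ∀ z, 0 < u z)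
    (hharm : ∀ z ∈ ball d n, ∑ p, u (z + uv d p) = 2 * d * u z) (K : ℝ)
    (hK : K = 2 * Real.sqrt (1100 * (2 * d) ^ 3)) (hKn : 2 * K ≤ n) (z : V d)
    (hz : nsq z ≤ ((n : ℝ) / 2) ^ 2) (p : Fin d × Bool) :
    (1 - K / n) ^ 2 * u z ≤ u (z + uv d p) := by
  have hn1 : (1:ℝ) ≤ n := by exact_mod_cast hn
  have hn0 : (0:ℝ) < n := by linarith
  set v : V d → ℝ := fun z => Real.sqrt (u z) with hvdef
  have hv : ∀ z, 0 < v z := fun z => Real.sqrt_pos.2 (hu z)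
  have hv2 : ∀ z, v z ^ 2 = u z := fun z => Real.sq_sqrt (hu z).le
  have hh : ∀ z ∈ ball d n, ∑ p, v (z + uv d p) ^ 2 = 2 * d * v z ^ 2 := by
    intro z hz; simp only [hv2]; exact hharm z hz
  have hzb : z ∈ ball d n := by
    rw [mem_ball_iff hn0.le]; nlinarith
  have hg := grad_est hd n hn v hv hh z hzb
  set C : ℝ := 1100 * (2 * d) ^ 3 with hC
  have hC0 : 0 ≤ C := by positivity
  have hK0 : 0 ≤ K := by rw [hK]; positivity
  have hK2 : K ^ 2 = 4 * C := by rw [hK, mul_pow, Real.sq_sqrt hC0]; norm_num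
  have hsub := ratio_sub_sq v hv z (hh z hzb)
  have hw0 : 0 ≤ ww v z := by
    have : 0 ≤ ∑ p, (v (z + uv d p) / v z - 1) ^ 2 := Finset.sum_nonneg fun i _ => sq_nonneg _
    linarith
  have hψ : 3 / 4 * (n:ℝ) ^ 2 ≤ (n : ℝ) ^ 2 - nsq z := by linarith
  have hψ2 : (3 / 4 * (n:ℝ) ^ 2) ^ 2 ≤ ((n : ℝ) ^ 2 - nsq z) ^ 2 := by gcongr
  have h1 : (3 / 4 * (n:ℝ) ^ 2) ^ 2 * ww v z ≤ C * n ^ 2 :=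
    (mul_le_mul_of_nonneg_right hψ2 hw0).trans hg
  have h2 : (n:ℝ) ^ 2 * (2 * ww v z) ≤ K ^ 2 := by
    have h3 : (n:ℝ) ^ 2 * ((n:ℝ) ^ 2 * (2 * ww v z)) ≤ (n:ℝ) ^ 2 * K ^ 2 := by
      have : 0 ≤ C * (n:ℝ) ^ 2 := by positivity
      rw [hK2]; linarith
    exact le_of_mul_le_mul_left h3 (by positivity)
  have h4 : (v (z + uv d p) / v z - 1) ^ 2 ≤ 2 * ww v z := by
    rw [← hsub]
    exact Finset.single_le_sum (f := fun p => (v (z + uv d p) / v z - 1) ^ 2)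
      (fun i _ => sq_nonneg _) (Finset.mem_univ p)
  have h5 : (v (z + uv d p) / v z - 1) ^ 2 ≤ (K / n) ^ 2 := by
    rw [div_pow, le_div_iff₀ (by positivity)]
    have := mul_le_mul_of_nonneg_left h4 (sq_nonneg (n:ℝ))
    linarith
  have h6 := (abs_le.1 (abs_le_of_sq_le_sq h5 (by positivity))).1
  have h7 : 0 ≤ 1 - K / n := by
    have : K / n ≤ 1 / 2 := by rw [div_le_iff₀ hn0]; linarith
    linarith
  have h8 : 1 - K / n ≤ v (z + uv d p) / v z := by linarith
  rw [le_div_iff₀ (hv z)] at h8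
  calc (1 - K / n) ^ 2 * u z = ((1 - K / n) * v z) ^ 2 := by rw [mul_pow, hv2]
    _ ≤ v (z + uv d p) ^ 2 := by
        apply pow_le_pow_left₀ (mul_nonneg h7 (hv z).le) h8
    _ = _ := hv2 _

lemma crude_est {d : ℕ} (hd : 1 ≤ d) (u : V d → ℝ) (hu : ∀ z, 0 < u z) (z : V d)
    (p : Fin d × Bool)
    (hharm : ∑ q, u (z + uv d p + uv d q) = 2 * d * u (z + uv d p)) :
    (1 / (2 * d)) * u z ≤ u (z + uv d p) := by
  have hd1 : (1:ℝ) ≤ d := by exact_mod_cast hd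
  have h := Finset.single_le_sum (f := fun q => u (z + uv d p + uv d q))
      (fun i _ => (hu _).le) (Finset.mem_univ (opp p))
  simp only [add_assoc, uv_opp, add_zero] at h
  simp only [add_assoc] at hharm
  rw [hharm] at h
  rw [one_div, inv_mul_le_iff₀ (by positivity)]
  exact h

lemma chain {d : ℕ} (u : V d → ℝ) (hu : ∀ z, 0 < u z) (r q : ℝ) (hq : 0 ≤ q)
    (hstep : ∀ z p, nsq z ≤ r → nsq (z + uv d p) ≤ r → q * u z ≤ u (z + uv d p)) (m : ℕ) :
    ∀ x : V d, ∑ i, (x i).natAbs = m → nsq x ≤ r → q ^ m * u 0 ≤ u x := by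
  induction m with
  | zero =>
    intro x hx _
    have : x = 0 := by
      ext i
      have := (Finset.sum_eq_zero_iff.1 hx) i (Finset.mem_univ i)
      simpa using this
    rw [this]; simp
  | succ m ih =>
    intro x hx hr
    obtain ⟨i, hi⟩ : ∃ i, x i ≠ 0 := by
      by_contra hc
      push Not at hc
      simp [hc] at hx
    set p : Fin d × Bool := (i, decide (0 < x i)) with hp
    set z : V d := x + uv d (opp p) with hz
    have hzx : z + uv d p = x := by
      rw [hz, add_assoc, add_comm (uv d (opp p)), uv_opp, add_zero]
    have hzi : ∀ j, j ≠ i → z j = x j := by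
      intro j hj; simp [hz, uv, opp, hp, hj]
    have hzi2 : (z i).natAbs + 1 = (x i).natAbs := by
      have : z i = x i + (if 0 < x i then -1 else 1) := by
        simp only [hz, hp, opp, uv, Pi.add_apply, if_true]
        by_cases h : 0 < x i <;> simp [h]
      rw [this]; split_ifs <;> omega
    have hsum : ∑ j, (z j).natAbs = m := by
      rw [← Finset.add_sum_erase _ _ (Finset.mem_univ i)] at hx ⊢
      have : ∑ j ∈ Finset.univ.erase i, (z j).natAbs = ∑ j ∈ Finset.univ.erase i, (x j).natAbs :=
        Finset.sum_congr rfl fun j hj => by rw [hzi j (Finset.ne_of_mem_erase hj)]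
      omega
    have hnz : nsq z ≤ nsq x := by
      refine Finset.sum_le_sum fun j _ => ?_
      by_cases hj : j = i
      · subst hj
        rw [sq_le_sq, ← Int.cast_abs, ← Int.cast_abs, Int.cast_le, Int.abs_eq_natAbs, Int.abs_eq_natAbs]
        omega
      · rw [hzi j hj]
    have h1 := ih z hsum (hnz.trans hr)
    have h2 := hstep z p (hnz.trans hr) (by rw [hzx]; exact hr)
    rw [hzx] at h2
    calc q ^ (m + 1) * u 0 = q * (q ^ m * u 0) := by ring
      _ ≤ q * u z := mul_le_mul_of_nonneg_left h1 hq
      _ ≤ u x := h2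

lemma harnack {d : ℕ} (hd : 1 ≤ d) : ∃ η : ℝ, 0 < η ∧ ∀ n : ℕ, 1 ≤ n → ∀ u : V d → ℝ,
    (∀ z, 0 < u z) → (∀ z ∈ ball d n, ∑ p, u (z + uv d p) = 2 * d * u z) →
    ∀ x ∈ ball d ((n : ℝ) / 2), η * u 0 ≤ u x := by
  have hd1 : (1:ℝ) ≤ d := by exact_mod_cast hd
  obtain ⟨K, hK⟩ : ∃ K : ℝ, K = 2 * Real.sqrt (1100 * (2 * d) ^ 3) := ⟨_, rfl⟩
  have hK0 : 0 ≤ K := by rw [hK]; positivity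
  set η1 : ℝ := Real.exp (-(4 * d * K)) with hη1
  set η2 : ℝ := (1 / (2 * d)) ^ (d * ⌈2 * K⌉₊) with hη2
  have hq1 : (1 / (2 * d) : ℝ) ≤ 1 := by rw [div_le_one (by positivity)]; linarith
  refine ⟨min η1 η2, lt_min (Real.exp_pos _) (by positivity), ?_⟩
  intro n hn u hu hharm x hx
  have hn1 : (1:ℝ) ≤ n := by exact_mod_cast hn
  have hn0 : (0:ℝ) < n := by linarith
  have hxr := (mem_ball_iff (by positivity) x).1 hx
  have hm : ∑ i, (x i).natAbs ≤ d * n := by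
    calc ∑ i, (x i).natAbs ≤ ∑ _i : Fin d, n := by
          refine Finset.sum_le_sum fun i _ => ?_
          have h1 := coord_abs_le (by positivity) hxr i
          have h2 : |(x i : ℝ)| ≤ n := by linarith
          rw [← Int.cast_abs, Int.abs_eq_natAbs] at h2
          exact_mod_cast h2
      _ = d * n := by simp
  by_cases hc : 2 * K ≤ n
  · set t := K / n with ht
    have ht0 : 0 ≤ t := by positivity
    have ht2 : t ≤ 1 / 2 := by rw [ht, div_le_iff₀ hn0]; linarith
    have hch := chain u hu (((n:ℝ) / 2) ^ 2) ((1 - t) ^ 2) (sq_nonneg _)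
      (fun z p hz _ => step_est hd n hn u hu hharm K hK hc z hz p) _ x rfl hxr
    refine le_trans (mul_le_mul_of_nonneg_right ?_ (hu 0).le) hch
    refine (min_le_left _ _).trans ?_
    have h1 : Real.exp (-(2 * t)) ≤ 1 - t := by
      rw [Real.exp_neg, inv_le_iff_one_le_mul₀ (Real.exp_pos _)]
      have := Real.add_one_le_exp (2 * t)
      nlinarith
    calc η1 = (Real.exp (-(2 * t)) ^ 2) ^ (d * n) := by
          rw [← Real.exp_nat_mul, ← Real.exp_nat_mul, hη1, ht]
          congr 1
          push_cast
          field_simp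
          ring
      _ ≤ ((1 - t) ^ 2) ^ (d * n) := by
          have := (Real.exp_pos (-(2 * t))).le
          gcongr
      _ ≤ _ := pow_le_pow_of_le_one (sq_nonneg _) (by nlinarith) hm
  · push Not at hc
    have hch := chain u hu (((n:ℝ) / 2) ^ 2) (1 / (2 * d)) (by positivity)
      (fun z p _ hz => crude_est hd u hu z p (hharm _ (by
        rw [mem_ball_iff hn0.le]; nlinarith))) _ x rfl hxr
    refine le_trans (mul_le_mul_of_nonneg_right ?_ (hu 0).le) hch
    refine (min_le_right _ _).trans ?_
    apply pow_le_pow_of_le_one (by positivity) hq1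
    refine hm.trans (Nat.mul_le_mul_left d ?_)
    have : (n:ℝ) ≤ ⌈2 * K⌉₊ := hc.le.trans (Nat.le_ceil _)
    exact_mod_cast this

end

end RW

theorem statement2 (d : ℕ) (hd : 2 ≤ d) :
    ∃ η : ℝ, 0 < η ∧ ∀ n : ℕ, 1 ≤ n → ∀ A : Finset (V d), ball d n ⊆ A →
      ∀ x ∈ ball d ((n : ℝ) / 2), ∀ y ∉ A,
        η * (hitProb A 0 y).toReal ≤ (hitProb A x y).toReal := by
  obtain ⟨η, hη, H⟩ := RW.harnack (d := d) (by omega)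
  refine ⟨η, hη, fun n hn A hA x hx y hy => ?_⟩
  have key : ∀ ε : ℝ, 0 < ε →
      η * (hitProb A 0 y).toReal ≤ (hitProb A x y).toReal + ε := by
    intro ε hε
    have h := H n hn (fun z => (hitProb A z y).toReal + ε)
      (fun z => add_pos_of_nonneg_of_pos ENNReal.toReal_nonneg hε)
      (fun z hz => by
        rw [Finset.sum_add_distrib, RW.h_harm (by omega) A z y (hA hz) hy]
        have := RW.card_idx d
        simp only [Finset.sum_const, Finset.card_univ, nsmul_eq_mul, ← this]
        ring) x hx
    have := mul_pos hη hε
    linarith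
  exact le_of_forall_pos_le_add key
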